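/- arXiv:1604.06382 — 2 statements merged into one kernel-verified Lean document; each statement's English description precedes it below -/
import Mathlib

section
/- Let T' be a finite tree, let v be an arbitrary vertex of T', and let T be the tree obtained from T' by adding three new vertices u₁, u₂, u₃ with edges u₁u₂ and u₂u₃, together with the edge vu₂. Then γ₂(T) = γ₂(T') + 2 and α₂(T) = α₂(T') + 2; in particular α₂(T) − γ₂(T) = α₂(T') − γ₂(T'). -/
open SimpleGraph

/-- `S` is a `k`-dominating set of the subgraph of `G` induced by `U`:
`S ⊆ U` and every vertex of `U` not in `S` has at least `k` neighbors in `S`. -/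
def IsKDomOn {V : Type*} (G : SimpleGraph V) (k : ℕ) (U S : Set V) : Prop :=
  S ⊆ U ∧ ∀ v ∈ U, v ∉ S → k ≤ (G.neighborSet v ∩ S).ncard

/-- `S` is a `k`-independent set of the subgraph of `G` induced by `U`:
`S ⊆ U` and every vertex of `S` has at most `k - 1` neighbors in `S`. -/
def IsKIndOn {V : Type*} (G : SimpleGraph V) (k : ℕ) (U S : Set V) : Prop :=
  S ⊆ U ∧ ∀ v ∈ S, (G.neighborSet v ∩ S).ncard ≤ k - 1

/-- The `k`-domination number of the subgraph of `G` induced by `U`. -/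
noncomputable def gammaK {V : Type*} (G : SimpleGraph V) (k : ℕ) (U : Set V) : ℕ :=
  sInf {n | ∃ S, IsKDomOn G k U S ∧ S.ncard = n}

/-- The `k`-independence number of the subgraph of `G` induced by `U`. -/
noncomputable def alphaK {V : Type*} (G : SimpleGraph V) (k : ℕ) (U : Set V) : ℕ :=
  sSup {n | ∃ S, IsKIndOn G k U S ∧ S.ncard = n}

theorem ncard_split {V : Type*} [Fintype V] (S : Set (V ⊕ Fin 3)) :
    S.ncard = (Sum.inl ⁻¹' S : Set V).ncard + (Sum.inr ⁻¹' S : Set (Fin 3)).ncard := by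
  have h : S = Sum.inl '' (Sum.inl ⁻¹' S : Set V) ∪ Sum.inr '' (Sum.inr ⁻¹' S : Set (Fin 3)) := by
    ext x; rcases x with x | x <;> simp
  conv_lhs => rw [h]
  rw [Set.ncard_union_eq _ (Set.toFinite _) (Set.toFinite _),
    Set.ncard_image_of_injective _ Sum.inl_injective,
    Set.ncard_image_of_injective _ Sum.inr_injective]
  rw [Set.disjoint_left]
  rintro _ ⟨x, _, rfl⟩ ⟨y, _, h⟩
  simp at h

theorem gamma_eq {V W : Type*} [Fintype V] [Fintype W] (G : SimpleGraph V) (H : SimpleGraph W)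
    (h1 : ∀ S, IsKDomOn H 2 Set.univ S → ∃ S', IsKDomOn G 2 Set.univ S' ∧ S'.ncard ≤ S.ncard + 2)
    (h2 : ∀ S, IsKDomOn G 2 Set.univ S → ∃ S', IsKDomOn H 2 Set.univ S' ∧ S'.ncard + 2 ≤ S.ncard) :
    gammaK G 2 Set.univ = gammaK H 2 Set.univ + 2 := by
  have ne : ∀ {X : Type _} (K : SimpleGraph X),
      {n | ∃ S, IsKDomOn K 2 Set.univ S ∧ S.ncard = n}.Nonempty := fun K =>
    ⟨_, Set.univ, ⟨le_rfl, fun v _ h => absurd (Set.mem_univ v) h⟩, rfl⟩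
  have ne' : ∀ {X : Type _} (K : SimpleGraph X),
      {n | ∃ S, IsKDomOn K 2 Set.univ S ∧ S.ncard = n}.Nonempty := fun K =>
    ⟨_, Set.univ, ⟨le_rfl, fun v _ h => absurd (Set.mem_univ v) h⟩, rfl⟩
  obtain ⟨S, hS, hc⟩ := Nat.sInf_mem (ne G)
  obtain ⟨R, hR, hd⟩ := Nat.sInf_mem (ne' H)
  obtain ⟨S', hS', hc'⟩ := h2 S hS
  obtain ⟨R', hR', hd'⟩ := h1 R hR
  have a := Nat.sInf_le (s := {n | ∃ S, IsKDomOn H 2 Set.univ S ∧ S.ncard = n}) ⟨S', hS', rfl⟩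
  have b := Nat.sInf_le (s := {n | ∃ S, IsKDomOn G 2 Set.univ S ∧ S.ncard = n}) ⟨R', hR', rfl⟩
  unfold gammaK
  omega

theorem alpha_eq {V W : Type*} [Fintype V] [Fintype W] (G : SimpleGraph V) (H : SimpleGraph W)
    (h1 : ∀ S, IsKIndOn H 2 Set.univ S → ∃ S', IsKIndOn G 2 Set.univ S' ∧ S.ncard + 2 ≤ S'.ncard)
    (h2 : ∀ S, IsKIndOn G 2 Set.univ S → ∃ S', IsKIndOn H 2 Set.univ S' ∧ S.ncard ≤ S'.ncard + 2) :
    alphaK G 2 Set.univ = alphaK H 2 Set.univ + 2 := by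
  have bd : BddAbove {n | ∃ S, IsKIndOn G 2 Set.univ S ∧ S.ncard = n} := by
    refine ⟨Nat.card V, ?_⟩
    rintro _ ⟨S, _, rfl⟩
    exact Set.ncard_le_card S
  have bd' : BddAbove {n | ∃ S, IsKIndOn H 2 Set.univ S ∧ S.ncard = n} := by
    refine ⟨Nat.card W, ?_⟩
    rintro _ ⟨S, _, rfl⟩
    exact Set.ncard_le_card S
  have ne : {n | ∃ S, IsKIndOn G 2 Set.univ S ∧ S.ncard = n}.Nonempty :=
    ⟨_, ∅, ⟨Set.empty_subset _, fun v h => absurd h (Set.notMem_empty v)⟩, rfl⟩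
  have ne' : {n | ∃ S, IsKIndOn H 2 Set.univ S ∧ S.ncard = n}.Nonempty :=
    ⟨_, ∅, ⟨Set.empty_subset _, fun v h => absurd h (Set.notMem_empty v)⟩, rfl⟩
  obtain ⟨S, hS, hc⟩ := Nat.sSup_mem ne bd
  obtain ⟨R, hR, hd⟩ := Nat.sSup_mem ne' bd'
  obtain ⟨S', hS', hc'⟩ := h2 S hS
  obtain ⟨R', hR', hd'⟩ := h1 R hR
  have a := le_csSup bd' ⟨S', hS', rfl⟩
  have b := le_csSup bd ⟨R', hR', rfl⟩
  unfold alphaK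
  omega

theorem stmt6 {V : Type*} [Fintype V] (T' : SimpleGraph V) (hT' : T'.IsTree)
    (v : V) (T : SimpleGraph (V ⊕ Fin 3))
    (hadj : ∀ a b, T.Adj a b ↔
      ((∃ x y, T'.Adj x y ∧ a = Sum.inl x ∧ b = Sum.inl y) ∨
       (a = (Sum.inr 0 : V ⊕ Fin 3) ∧ b = Sum.inr 1) ∨ (a = Sum.inr 1 ∧ b = (Sum.inr 0 : V ⊕ Fin 3)) ∨
       (a = (Sum.inr 1 : V ⊕ Fin 3) ∧ b = Sum.inr 2) ∨ (a = Sum.inr 2 ∧ b = (Sum.inr 1 : V ⊕ Fin 3)) ∨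
       (a = Sum.inl v ∧ b = (Sum.inr 1 : V ⊕ Fin 3)) ∨ (a = (Sum.inr 1 : V ⊕ Fin 3) ∧ b = Sum.inl v))) :
    gammaK T 2 Set.univ = gammaK T' 2 Set.univ + 2 ∧
    alphaK T 2 Set.univ = alphaK T' 2 Set.univ + 2 ∧
    (alphaK T 2 Set.univ : ℤ) - (gammaK T 2 Set.univ : ℤ) =
      (alphaK T' 2 Set.univ : ℤ) - (gammaK T' 2 Set.univ : ℤ) := by
  classical
  have adj_ll : ∀ x y, T.Adj (Sum.inl x) (Sum.inl y) ↔ T'.Adj x y := by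
    intro x y; rw [hadj]; simp
  have adj_l : ∀ x i, T.Adj (Sum.inl x) (Sum.inr i) ↔ x = v ∧ i = 1 := by
    intro x i; rw [hadj]; simp
  have adj_0 : ∀ a, T.Adj (Sum.inr 0) a ↔ a = Sum.inr 1 := by
    intro a; rw [hadj]; simp
  have adj_2 : ∀ a, T.Adj (Sum.inr 2) a ↔ a = Sum.inr 1 := by
    intro a; rw [hadj]; simp
  have adj_10 : T.Adj (Sum.inr 1) (Sum.inr 0) := ((adj_0 _).2 rfl).symm
  have adj_12 : T.Adj (Sum.inr 1) (Sum.inr 2) := ((adj_2 _).2 rfl).symm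
  have pr : ({Sum.inr 0, Sum.inr 2} : Set (V ⊕ Fin 3)).ncard = 2 := Set.ncard_pair (by simp)
  have pr' : ({0, 2} : Set (Fin 3)).ncard = 2 := Set.ncard_pair (by simp)
  -- neighbours of old vertices
  have nle : ∀ x (S : Set (V ⊕ Fin 3)), (T'.neighborSet x ∩ Sum.inl ⁻¹' S).ncard ≤
      (T.neighborSet (Sum.inl x) ∩ S).ncard := by
    intro x S
    rw [← Set.ncard_image_of_injective _ (Sum.inl_injective (α := V) (β := Fin 3))]
    apply Set.ncard_le_ncard _ (Set.toFinite _)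
    rintro _ ⟨y, ⟨hy, hyS⟩, rfl⟩
    exact ⟨(adj_ll _ _).2 hy, hyS⟩
  have nge : ∀ x (S : Set (V ⊕ Fin 3)), (x = v → Sum.inr 1 ∉ S) →
      (T.neighborSet (Sum.inl x) ∩ S).ncard ≤ (T'.neighborSet x ∩ Sum.inl ⁻¹' S).ncard := by
    intro x S h
    rw [← Set.ncard_image_of_injective (T'.neighborSet x ∩ Sum.inl ⁻¹' S)
      (Sum.inl_injective (α := V) (β := Fin 3))]
    apply Set.ncard_le_ncard _ (Set.toFinite _)
    rintro (y | i) ⟨hy, hyS⟩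
    · exact ⟨y, ⟨(adj_ll _ _).1 hy, hyS⟩, rfl⟩
    · obtain ⟨h1, rfl⟩ := (adj_l _ _).1 hy
      exact absurd hyS (h h1)
  -- the extension of a set of old vertices
  let E : Set V → Set (V ⊕ Fin 3) := fun S => Sum.inl '' S ∪ Sum.inr '' {0, 2}
  have El : ∀ S, Sum.inl ⁻¹' (E S) = S := by intro S; ext x; simp [E]
  have Er : ∀ S, Sum.inr ⁻¹' (E S) = ({0, 2} : Set (Fin 3)) := by
    intro S; ext x; simp [E, eq_comm]
  have E1 : ∀ S, Sum.inr 1 ∉ E S := by intro S; simp [E]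
  have Ec : ∀ S, (E S).ncard = S.ncard + 2 := by
    intro S; rw [ncard_split, El, Er, pr']
  have hγ : gammaK T 2 Set.univ = gammaK T' 2 Set.univ + 2 := by
    apply gamma_eq
    · intro S hS
      refine ⟨E S, ⟨Set.subset_univ _, ?_⟩, (Ec S).le⟩
      rintro (x | i) _ hx
      · have := nle x (E S)
        rw [El] at this
        exact (hS.2 x trivial (fun h => hx (Or.inl ⟨x, h, rfl⟩))).trans this
      · rw [← pr]
        apply Set.ncard_le_ncard _ (Set.toFinite _)
        have hi : i = 1 := by
          fin_cases i
          · simp [E] at hx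
          · rfl
          · simp [E] at hx
        subst hi
        rintro _ (rfl | rfl)
        · exact ⟨adj_10, by simp [E]⟩
        · exact ⟨adj_12, by simp [E]⟩
    · intro S hS
      have leaf : ∀ i, (∀ a, T.Adj (Sum.inr i) a ↔ a = Sum.inr 1) → Sum.inr i ∈ S := by
        intro i hi
        by_contra h
        have h2 := hS.2 _ trivial h
        have : (T.neighborSet (Sum.inr i) ∩ S).ncard ≤ ({Sum.inr 1} : Set (V ⊕ Fin 3)).ncard := by
          apply Set.ncard_le_ncard _ (Set.toFinite _)
          rintro a ⟨ha, _⟩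
          exact (hi a).1 ha
        rw [Set.ncard_singleton] at this
        omega
      have h0 := leaf 0 adj_0
      have h2 := leaf 2 adj_2
      have hc := ncard_split S
      by_cases h1 : Sum.inr 1 ∈ S
      · have hQ : (Sum.inr ⁻¹' S : Set (Fin 3)) = Set.univ := by
          ext i; fin_cases i <;> simpa
        rw [hQ, Set.ncard_univ, Nat.card_fin] at hc
        refine ⟨insert v (Sum.inl ⁻¹' S), ⟨Set.subset_univ _, ?_⟩, ?_⟩
        · intro x _ hx
          rw [Set.mem_insert_iff, not_or] at hx
          refine (hS.2 (Sum.inl x) trivial hx.2).trans ((nge x S (fun h => absurd h hx.1)).trans ?_)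
          apply Set.ncard_le_ncard _ (Set.toFinite _)
          exact Set.inter_subset_inter_right _ (Set.subset_insert _ _)
        · have := Set.ncard_insert_le v (Sum.inl ⁻¹' S)
          omega
      · have hQ : (Sum.inr ⁻¹' S : Set (Fin 3)) = {0, 2} := by
          ext i; fin_cases i <;> simpa
        rw [hQ, pr'] at hc
        refine ⟨Sum.inl ⁻¹' S, ⟨Set.subset_univ _, ?_⟩, hc.ge⟩
        intro x _ hx
        exact (hS.2 (Sum.inl x) trivial hx).trans (nge x S (fun _ => h1))
  have hα : alphaK T 2 Set.univ = alphaK T' 2 Set.univ + 2 := by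
    apply alpha_eq
    · intro S hS
      refine ⟨E S, ⟨Set.subset_univ _, ?_⟩, (Ec S).ge⟩
      rintro (x | i) hx
      · have := nge x (E S) (fun _ => E1 S)
        rw [El] at this
        refine this.trans (hS.2 x ?_)
        rw [← El S]; exact hx
      · have : T.neighborSet (Sum.inr i) ∩ E S = ∅ := by
          ext a
          simp only [Set.mem_inter_iff, Set.mem_empty_iff_false, iff_false, not_and]
          intro ha haS
          have : a = Sum.inr 1 := by
            fin_cases i
            · exact (adj_0 a).1 ha
            · exact absurd hx (E1 S)
            · exact (adj_2 a).1 ha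
          exact E1 S (this ▸ haS)
        rw [this]; simp
    · intro S hS
      refine ⟨Sum.inl ⁻¹' S, ⟨Set.subset_univ _, fun x hx => (nle x S).trans (hS.2 _ hx)⟩, ?_⟩
      rw [ncard_split S]
      have hQ : (Sum.inr ⁻¹' S : Set (Fin 3)) ≠ Set.univ := by
        intro h
        have m : ∀ i : Fin 3, Sum.inr i ∈ S := fun i => by
          have : i ∈ (Sum.inr ⁻¹' S : Set (Fin 3)) := h ▸ Set.mem_univ i
          exact this
        have h1 := hS.2 _ (m 1)
        have : ({Sum.inr 0, Sum.inr 2} : Set (V ⊕ Fin 3)).ncard ≤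
            (T.neighborSet (Sum.inr 1) ∩ S).ncard := by
          apply Set.ncard_le_ncard _ (Set.toFinite _)
          rintro _ (rfl | rfl)
          · exact ⟨adj_10, m 0⟩
          · exact ⟨adj_12, m 2⟩
        omega
      have := Set.ncard_lt_ncard ((Set.ssubset_univ_iff).2 hQ) (Set.toFinite _)
      rw [Set.ncard_univ, Nat.card_fin] at this
      omega
  refine ⟨hγ, hα, ?_⟩
  rw [hγ, hα]; push_cast; ring
end

section
/- Let T' be a finite tree containing nine distinct vertices v₁, v₂, ℓ₂, a, ℓ₁, b, c, d such that v₂ is adjacent to v₁, ℓ₂, and a; a is adjacent to ℓ₁ and b; and b–c–d is a path; where in T' the degrees satisfy deg(ℓ₁) = deg(ℓ₂) = deg(d) = 1, deg(b) = deg(c) = 2, and deg(v₂) = deg(a) = 3. Let T be the tree obtained from T' by deleting the edge v₁v₂ and adding three new vertices u₁, u₂, u₃ together with the edges u₁u₂, u₂u₃, v₁u₁, and v₂u₂. Then γ₂(T) = γ₂(T') + 2 and α₂(T) = α₂(T') + 2; in particular α₂(T) − γ₂(T) = α₂(T') − γ₂(T'). -/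
open SimpleGraph

/-- The local structure of the tree `T'` around the gadget. -/
structure Gad {V : Type*} (T' : SimpleGraph V) (v₁ v₂ ℓ₂ a ℓ₁ b c d : V) : Prop where
  dist : ([v₁, v₂, ℓ₂, a, ℓ₁, b, c, d] : List V).Pairwise (· ≠ ·)
  nv2 : ∀ x, T'.Adj v₂ x ↔ x = v₁ ∨ x = ℓ₂ ∨ x = a
  nl2 : ∀ x, T'.Adj ℓ₂ x ↔ x = v₂
  na : ∀ x, T'.Adj a x ↔ x = v₂ ∨ x = ℓ₁ ∨ x = b
  nl1 : ∀ x, T'.Adj ℓ₁ x ↔ x = a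
  nb : ∀ x, T'.Adj b x ↔ x = a ∨ x = c
  nc : ∀ x, T'.Adj c x ↔ x = b ∨ x = d
  nd : ∀ x, T'.Adj d x ↔ x = c

/-- The adjacency relation of the modified tree. -/
structure GadT {V : Type*} (T' : SimpleGraph V) (T : SimpleGraph (V ⊕ Fin 3)) (v₁ v₂ : V) :
    Prop where
  ll : ∀ x y, T.Adj (Sum.inl x) (Sum.inl y) ↔
    T'.Adj x y ∧ ¬(x = v₁ ∧ y = v₂) ∧ ¬(x = v₂ ∧ y = v₁)
  l0 : ∀ x, T.Adj (Sum.inl x) (Sum.inr 0) ↔ x = v₁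
  l1 : ∀ x, T.Adj (Sum.inl x) (Sum.inr 1) ↔ x = v₂
  l2 : ∀ x, ¬ T.Adj (Sum.inl x) (Sum.inr 2)
  r01 : T.Adj (Sum.inr 0) (Sum.inr 1)
  r12 : T.Adj (Sum.inr 1) (Sum.inr 2)
  r02 : ¬ T.Adj (Sum.inr 0) (Sum.inr 2)

/-- Indicator of membership. -/
noncomputable def memInd {W : Type*} (S : Set W) (x : W) : ℕ := by
  classical exact if x ∈ S then 1 else 0

lemma memInd_of_mem {W : Type*} {S : Set W} {x : W} (h : x ∈ S) : memInd S x = 1 := by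
  simp [memInd, h]

lemma memInd_of_notMem {W : Type*} {S : Set W} {x : W} (h : x ∉ S) : memInd S x = 0 := by
  simp [memInd, h]

lemma ncard_split_one {W : Type*} [Finite W] (S : Set W) (x : W) :
    S.ncard = (S \ {x}).ncard + memInd S x := by
  by_cases h : x ∈ S
  · rw [memInd_of_mem h, Set.ncard_sdiff_singleton_add_one h]
  · rw [memInd_of_notMem h, Set.sdiff_singleton_eq_self h]; rfl

lemma memInd_diff {W : Type*} (S H : Set W) (x : W) (h : x ∉ H) :
    memInd (S \ H) x = memInd S x := by
  by_cases hx : x ∈ S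
  · rw [memInd_of_mem hx, memInd_of_mem (show x ∈ S \ H from ⟨hx, h⟩)]
  · rw [memInd_of_notMem hx, memInd_of_notMem fun h' => hx h'.1]

lemma ncard_split_H {V : Type*} [Finite V] (S : Set V) {v₂ ℓ₂ a ℓ₁ b c d : V}
    (hd : ([v₂, ℓ₂, a, ℓ₁, b, c, d] : List V).Pairwise (· ≠ ·)) :
    S.ncard = (S \ {v₂, ℓ₂, a, ℓ₁, b, c, d}).ncard + memInd S v₂ + memInd S ℓ₂ + memInd S a
      + memInd S ℓ₁ + memInd S b + memInd S c + memInd S d := by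
  simp only [List.pairwise_cons, List.mem_cons] at hd
  have e : S \ {v₂, ℓ₂, a, ℓ₁, b, c, d} =
    ((((((S \ {v₂}) \ {ℓ₂}) \ {a}) \ {ℓ₁}) \ {b}) \ {c}) \ {d} := by
    ext x; simp only [Set.mem_sdiff, Set.mem_insert_iff, Set.mem_singleton_iff]; tauto
  rw [e, ncard_split_one S v₂, ncard_split_one (S \ {v₂}) ℓ₂,
    ncard_split_one ((S \ {v₂}) \ {ℓ₂}) a,
    ncard_split_one (((S \ {v₂}) \ {ℓ₂}) \ {a}) ℓ₁,
    ncard_split_one ((((S \ {v₂}) \ {ℓ₂}) \ {a}) \ {ℓ₁}) b,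
    ncard_split_one (((((S \ {v₂}) \ {ℓ₂}) \ {a}) \ {ℓ₁}) \ {b}) c,
    ncard_split_one ((((((S \ {v₂}) \ {ℓ₂}) \ {a}) \ {ℓ₁}) \ {b}) \ {c}) d]
  repeat rw [memInd_diff _ {v₂} _ (by grind)]
  repeat rw [memInd_diff _ {ℓ₂} _ (by grind)]
  repeat rw [memInd_diff _ {a} _ (by grind)]
  repeat rw [memInd_diff _ {ℓ₁} _ (by grind)]
  repeat rw [memInd_diff _ {b} _ (by grind)]
  repeat rw [memInd_diff _ {c} _ (by grind)]
  simp only [memInd, Set.mem_sdiff, Set.mem_singleton_iff]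
  grind

lemma ncard_split_sum {V : Type*} [Finite V] (S : Set (V ⊕ Fin 3)) :
    S.ncard = (Sum.inl ⁻¹' S : Set V).ncard + memInd S (Sum.inr 0) + memInd S (Sum.inr 1)
      + memInd S (Sum.inr 2) := by
  have e : ((S \ {Sum.inr 0}) \ {Sum.inr 1}) \ {Sum.inr 2} = Sum.inl '' (Sum.inl ⁻¹' S : Set V) := by
    ext x
    rcases x with x | x
    · simp
    · fin_cases x <;> simp
  rw [ncard_split_one S (Sum.inr 0), ncard_split_one (S \ {Sum.inr 0}) (Sum.inr 1),
    ncard_split_one ((S \ {Sum.inr 0}) \ {Sum.inr 1}) (Sum.inr 2), e,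
    Set.ncard_image_of_injective _ Sum.inl_injective]
  simp only [memInd, Set.mem_sdiff, Set.mem_singleton_iff]
  grind

lemma dom_iff {W : Type*} [Finite W] (G : SimpleGraph W) (S : Set W) :
    IsKDomOn G 2 Set.univ S ↔
      ∀ v, v ∉ S → ∃ x y, G.Adj v x ∧ G.Adj v y ∧ x ∈ S ∧ y ∈ S ∧ x ≠ y := by
  simp only [IsKDomOn, Set.subset_univ, true_and, Set.mem_univ, true_implies]
  refine forall_congr' fun v => forall_congr' fun _ => ?_
  rw [← Nat.lt_iff_add_one_le, Set.one_lt_ncard_iff]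
  constructor
  · rintro ⟨x, y, ⟨h1, h2⟩, ⟨h3, h4⟩, h5⟩; exact ⟨x, y, h1, h3, h2, h4, h5⟩
  · rintro ⟨x, y, h1, h3, h2, h4, h5⟩; exact ⟨x, y, ⟨h1, h2⟩, ⟨h3, h4⟩, h5⟩

lemma ind_iff {W : Type*} [Finite W] (G : SimpleGraph W) (S : Set W) :
    IsKIndOn G 2 Set.univ S ↔
      ∀ v, v ∈ S → ∀ x y, G.Adj v x → G.Adj v y → x ∈ S → y ∈ S → x = y := by
  simp only [IsKIndOn, Set.subset_univ, true_and]
  refine forall_congr' fun v => forall_congr' fun _ => ?_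
  rw [Set.ncard_le_one_iff]
  constructor
  · intro h x y h1 h2 h3 h4; exact h ⟨h1, h3⟩ ⟨h2, h4⟩
  · rintro h x y ⟨h1, h2⟩ ⟨h3, h4⟩; exact h x y h1 h3 h2 h4

/-- Glue together a set on `V` outside the gadget, a set inside, and a set on the new vertices. -/
def glueV {V : Type*} (S H F : Set V) : Set V := {x | (x ∈ S ∧ x ∉ H) ∨ x ∈ F}

/-- A subset of the sum type. -/
def glueT {V : Type*} (P : Set V) (Q : Set (Fin 3)) : Set (V ⊕ Fin 3) :=
  {z | Sum.elim (· ∈ P) (· ∈ Q) z}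

lemma mem_glueT_l {V : Type*} (P : Set V) (Q : Set (Fin 3)) (x : V) :
    (Sum.inl x ∈ glueT P Q) ↔ x ∈ P := Iff.rfl

lemma mem_glueT_r {V : Type*} (P : Set V) (Q : Set (Fin 3)) (x : Fin 3) :
    (Sum.inr x ∈ glueT P Q) ↔ x ∈ Q := Iff.rfl

lemma glueV_diff {V : Type*} (S H F : Set V) (h : F ⊆ H) : glueV S H F \ H = S \ H := by
  ext x; simp only [glueV, Set.mem_sdiff, Set.mem_ofPred_eq]
  constructor
  · rintro ⟨h1 | h1, h2⟩
    · exact h1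
    · exact absurd (h h1) h2
  · rintro h1; exact ⟨Or.inl h1, h1.2⟩

section
variable {V : Type*} [Finite V] {T' : SimpleGraph V} {T : SimpleGraph (V ⊕ Fin 3)}
  {v₁ v₂ ℓ₂ a ℓ₁ b c d : V}

lemma Gad.facts (g : Gad T' v₁ v₂ ℓ₂ a ℓ₁ b c d) (P : Set V)
    (h : IsKDomOn T' 2 Set.univ P) :
    ℓ₁ ∈ P ∧ ℓ₂ ∈ P ∧ d ∈ P ∧ (c ∈ P ∨ b ∈ P) ∧ (b ∈ P ∨ a ∈ P) ∧
      (v₂ ∈ P ∨ a ∈ P ∨ v₁ ∈ P) := by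
  rw [dom_iff] at h
  obtain ⟨hd, hv2, hl2, ha, hl1, hb, hc, hdd⟩ := g
  have e1 := h ℓ₁
  have e2 := h ℓ₂
  have e3 := h d
  have e4 := h c
  have e5 := h b
  have e6 := h v₂
  simp only [hv2, hl2, hl1, hb, hc, hdd] at e1 e2 e3 e4 e5 e6
  clear h hd ha hv2 hl2 hl1 hb hc hdd
  grind

lemma Gad.factsT (g : Gad T' v₁ v₂ ℓ₂ a ℓ₁ b c d) (gt : GadT T' T v₁ v₂) (S : Set (V ⊕ Fin 3))
    (h : IsKDomOn T 2 Set.univ S) :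
    Sum.inl ℓ₁ ∈ S ∧ Sum.inl ℓ₂ ∈ S ∧ Sum.inl d ∈ S ∧ (Sum.inl c ∈ S ∨ Sum.inl b ∈ S) ∧
     (Sum.inl b ∈ S ∨ Sum.inl a ∈ S) ∧
      (Sum.inl v₂ ∈ S ∨ Sum.inl a ∈ S ∨ Sum.inr 1 ∈ S) ∧ Sum.inr 2 ∈ S ∧
      (Sum.inr 0 ∈ S ∨ (Sum.inr 1 ∈ S ∧ Sum.inl v₁ ∈ S)) := by
  rw [dom_iff] at h
  obtain ⟨hd, hv2, hl2, ha, hl1, hb, hc, hdd⟩ := g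
  obtain ⟨ll, l0, l1, l2, r01, r12, r02⟩ := gt
  simp only [List.pairwise_cons, List.mem_cons] at hd
  have s0 : ∀ x, T.Adj (Sum.inr 0) (Sum.inl x) ↔ x = v₁ := fun x => by rw [T.adj_comm, l0]
  have s1 : ∀ x, T.Adj (Sum.inr 1) (Sum.inl x) ↔ x = v₂ := fun x => by rw [T.adj_comm, l1]
  have s2 : ∀ x, ¬ T.Adj (Sum.inr 2) (Sum.inl x) := fun x => by rw [T.adj_comm]; exact l2 x
  have q1 : ¬ T.Adj (Sum.inr 2) (Sum.inr 0) := by rwa [T.adj_comm]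
  have n1 : ∀ z, T.Adj (Sum.inl ℓ₁) z → z = Sum.inl a := by
    rintro (z | z)
    · grind
    · fin_cases z <;> grind
  have n2 : ∀ z, T.Adj (Sum.inl ℓ₂) z → z = Sum.inl v₂ := by
    rintro (z | z)
    · grind
    · fin_cases z <;> grind
  have n3 : ∀ z, T.Adj (Sum.inl d) z → z = Sum.inl c := by
    rintro (z | z)
    · grind
    · fin_cases z <;> grind
  have n4 : ∀ z, T.Adj (Sum.inl c) z → z = Sum.inl b ∨ z = Sum.inl d := by
    rintro (z | z)
    · grind
    · fin_cases z <;> grind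
  have n5 : ∀ z, T.Adj (Sum.inl b) z → z = Sum.inl a ∨ z = Sum.inl c := by
    rintro (z | z)
    · grind
    · fin_cases z <;> grind
  have n6 : ∀ z, T.Adj (Sum.inl v₂) z → z = Sum.inl ℓ₂ ∨ z = Sum.inl a ∨ z = Sum.inr 1 := by
    rintro (z | z)
    · grind
    · fin_cases z <;> grind
  have n7 : ∀ z, T.Adj (Sum.inr 2) z → z = Sum.inr 1 := by
    rintro (z | z)
    · grind
    · fin_cases z <;> grind [SimpleGraph.irrefl]
  have n8 : ∀ z, T.Adj (Sum.inr 0) z → z = Sum.inr 1 ∨ z = Sum.inl v₁ := by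
    rintro (z | z)
    · grind
    · fin_cases z <;> grind [SimpleGraph.irrefl]
  have e1 := h (Sum.inl ℓ₁)
  have e2 := h (Sum.inl ℓ₂)
  have e3 := h (Sum.inl d)
  have e4 := h (Sum.inl c)
  have e5 := h (Sum.inl b)
  have e6 := h (Sum.inl v₂)
  have e7 := h (Sum.inr 2)
  have e8 := h (Sum.inr 0)
  clear h ll l0 l1 l2 s0 s1 s2 hv2 hl2 ha hl1 hb hc hdd hd r01 r12 r02 q1
  refine ⟨?_, ?_, ?_, ?_, ?_, ?_, ?_, ?_⟩
  · clear e2 e3 e4 e5 e6 e7 e8; grind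
  · clear e1 e3 e4 e5 e6 e7 e8; grind
  · clear e1 e2 e4 e5 e6 e7 e8; grind
  · clear e1 e2 e3 e5 e6 e7 e8; grind
  · clear e1 e2 e3 e4 e6 e7 e8; grind
  · clear e1 e2 e3 e4 e5 e7 e8; grind
  · clear e1 e2 e3 e4 e5 e6 e8; grind
  · clear e1 e2 e3 e4 e5 e6 e7; grind

end

section
variable {V : Type*} [Finite V] {T' : SimpleGraph V} {T : SimpleGraph (V ⊕ Fin 3)}
  {v₁ v₂ ℓ₂ a ℓ₁ b c d : V}

/-- Neighbours of vertices outside the gadget. -/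
lemma Gad.out (g : Gad T' v₁ v₂ ℓ₂ a ℓ₁ b c d) (x y : V)
    (hx : x ∉ ({v₂, ℓ₂, a, ℓ₁, b, c, d} : Set V)) (h : T'.Adj x y) :
    (y ∉ ({v₂, ℓ₂, a, ℓ₁, b, c, d} : Set V)) ∨ (x = v₁ ∧ y = v₂) := by
  obtain ⟨hd, hv2, hl2, ha, hl1, hb, hc, hdd⟩ := g
  have h' := h.symm
  simp only [Set.mem_insert_iff, Set.mem_singleton_iff] at *
  grind

lemma domT_of_glue (g : Gad T' v₁ v₂ ℓ₂ a ℓ₁ b c d) (gt : GadT T' T v₁ v₂) (S' : Set V)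
    (h : IsKDomOn T' 2 Set.univ S') (F : Set V) (Q : Set (Fin 3))
    (hF : (F = {ℓ₁, ℓ₂, d, b} ∧ Q = {1, 2} ∧ v₁ ∈ S') ∨ (F = {ℓ₁, ℓ₂, d, v₂, b} ∧ Q = {0, 2})) :
    IsKDomOn T 2 Set.univ (glueT (glueV S' {v₂, ℓ₂, a, ℓ₁, b, c, d} F) Q) := by
  have out := g.out
  rw [dom_iff] at h ⊢
  obtain ⟨hd, hv2, hl2, ha, hl1, hb, hc, hdd⟩ := g
  obtain ⟨ll, l0, l1, l2, r01, r12, r02⟩ := gt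
  simp only [List.pairwise_cons, List.mem_cons] at hd
  have r10 := r01.symm
  have r21 := r12.symm
  have s0 : ∀ x, T.Adj (Sum.inr 0) (Sum.inl x) ↔ x = v₁ := fun x => by rw [T.adj_comm, l0]
  have s1 : ∀ x, T.Adj (Sum.inr 1) (Sum.inl x) ↔ x = v₂ := fun x => by rw [T.adj_comm, l1]
  set H : Set V := {v₂, ℓ₂, a, ℓ₁, b, c, d} with hH
  set S := glueT (glueV S' H F) Q with hS
  have mr : ∀ x, Sum.inr x ∈ S ↔ x ∈ Q := fun x => Iff.rfl
  have ml : ∀ x, Sum.inl x ∈ S ↔ (x ∈ S' ∧ x ∉ H) ∨ x ∈ F := fun x => Iff.rfl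
  have mH : ∀ x, x ∈ H ↔ x = v₂ ∨ x = ℓ₂ ∨ x = a ∨ x = ℓ₁ ∨ x = b ∨ x = c ∨ x = d :=
    fun x => by simp [hH]
  clear_value S H
  rintro (x | x) hx
  · by_cases xH : x ∈ H
    · rw [mH] at xH
      rcases hF with ⟨rfl, rfl, hv⟩ | ⟨rfl, rfl⟩
      · simp only [Set.mem_insert_iff, Set.mem_singleton_iff] at mr ml
        rcases xH with rfl | rfl | rfl | rfl | rfl | rfl | rfl
        · exact ⟨Sum.inl ℓ₂, Sum.inr 1, by grind, by grind, by grind, by grind, by grind⟩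
        · grind
        · exact ⟨Sum.inl ℓ₁, Sum.inl b, by grind, by grind, by grind, by grind, by grind⟩
        · grind
        · grind
        · exact ⟨Sum.inl b, Sum.inl d, by grind, by grind, by grind, by grind, by grind⟩
        · grind
      · simp only [Set.mem_insert_iff, Set.mem_singleton_iff] at mr ml
        rcases xH with rfl | rfl | rfl | rfl | rfl | rfl | rfl
        · grind
        · grind
        · exact ⟨Sum.inl ℓ₁, Sum.inl b, by grind, by grind, by grind, by grind, by grind⟩
        · grind
        · grind
        · exact ⟨Sum.inl b, Sum.inl d, by grind, by grind, by grind, by grind, by grind⟩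
        · grind
    · have hxS : x ∉ S' := by grind
      obtain ⟨y, z, hy, hz, yS, zS, hyz⟩ := h x hxS
      have oy := out x y xH hy
      have oz := out x z xH hz
      have vH : v₂ ∈ H := by grind
      by_cases y2 : y = v₂
      · have q0 : 0 ∈ Q := by
          rcases hF with ⟨rfl, rfl, hv⟩ | ⟨rfl, rfl⟩
          · grind
          · simp
        refine ⟨Sum.inr 0, Sum.inl z, ?_, ?_, ?_, ?_, ?_⟩
        all_goals clear hF; grind
      · by_cases z2 : z = v₂
        · have q0 : 0 ∈ Q := by
            rcases hF with ⟨rfl, rfl, hv⟩ | ⟨rfl, rfl⟩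
            · grind
            · simp
          refine ⟨Sum.inl y, Sum.inr 0, ?_, ?_, ?_, ?_, ?_⟩
          all_goals clear hF; grind
        · refine ⟨Sum.inl y, Sum.inl z, ?_, ?_, ?_, ?_, ?_⟩
          all_goals clear hF; grind
  · rcases hF with ⟨rfl, rfl, hv⟩ | ⟨rfl, rfl⟩
    · fin_cases x
      · exact ⟨Sum.inl v₁, Sum.inr 1, by grind, by grind, by grind, by rw [mr]; simp, by grind⟩
      · exact absurd ((mr 1).2 (by simp)) hx
      · exact absurd ((mr 2).2 (by simp)) hx
    · fin_cases x
      · exact absurd ((mr 0).2 (by simp)) hx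
      · exact ⟨Sum.inr 0, Sum.inr 2, by grind, by grind, by rw [mr]; simp, by rw [mr]; simp,
          by simp⟩
      · exact absurd ((mr 2).2 (by simp)) hx

lemma dom_of_glue (g : Gad T' v₁ v₂ ℓ₂ a ℓ₁ b c d) (gt : GadT T' T v₁ v₂) (S : Set (V ⊕ Fin 3))
    (h : IsKDomOn T 2 Set.univ S) (F : Set V)
    (hF : (F = {ℓ₁, ℓ₂, d, b} ∧ Sum.inl v₁ ∈ S) ∨ (F = {ℓ₁, ℓ₂, d, v₂, b})) :
    IsKDomOn T' 2 Set.univ (glueV (Sum.inl ⁻¹' S) {v₂, ℓ₂, a, ℓ₁, b, c, d} F) := by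
  have out := g.out
  rw [dom_iff] at h ⊢
  obtain ⟨hd, hv2, hl2, ha, hl1, hb, hc, hdd⟩ := g
  obtain ⟨ll, l0, l1, l2, r01, r12, r02⟩ := gt
  simp only [List.pairwise_cons, List.mem_cons] at hd
  set H : Set V := {v₂, ℓ₂, a, ℓ₁, b, c, d} with hH
  set P := glueV (Sum.inl ⁻¹' S) H F with hP
  have ml : ∀ x, x ∈ P ↔ (Sum.inl x ∈ S ∧ x ∉ H) ∨ x ∈ F := fun x => Iff.rfl
  have mH : ∀ x, x ∈ H ↔ x = v₂ ∨ x = ℓ₂ ∨ x = a ∨ x = ℓ₁ ∨ x = b ∨ x = c ∨ x = d :=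
    fun x => by simp [hH]
  clear_value P H
  intro x hx
  by_cases xH : x ∈ H
  · rw [mH] at xH
    rcases hF with ⟨rfl, hv⟩ | rfl
    · simp only [Set.mem_insert_iff, Set.mem_singleton_iff] at ml
      rcases xH with rfl | rfl | rfl | rfl | rfl | rfl | rfl
      · exact ⟨ℓ₂, v₁, by grind, by grind, by grind, by grind, by grind⟩
      · grind
      · exact ⟨ℓ₁, b, by grind, by grind, by grind, by grind, by grind⟩
      · grind
      · grind
      · exact ⟨b, d, by grind, by grind, by grind, by grind, by grind⟩
      · grind
    · simp only [Set.mem_insert_iff, Set.mem_singleton_iff] at ml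
      rcases xH with rfl | rfl | rfl | rfl | rfl | rfl | rfl
      · grind
      · grind
      · exact ⟨ℓ₁, b, by grind, by grind, by grind, by grind, by grind⟩
      · grind
      · grind
      · exact ⟨b, d, by grind, by grind, by grind, by grind, by grind⟩
      · grind
  · have hxS : Sum.inl x ∉ S := by grind
    have vH : v₂ ∈ H := by grind
    have key : ∀ z, T.Adj (Sum.inl x) z → z ∈ S → (∃ y, z = Sum.inl y ∧ y ≠ v₂ ∧ T'.Adj x y ∧ y ∈ P)
        ∨ (z = Sum.inr 0 ∧ T'.Adj x v₂ ∧ v₂ ∈ P) := by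
      rintro (z | z) hz hzS
      · left
        have := (ll x z).1 hz
        have := out x z xH this.1
        refine ⟨z, rfl, ?_, ?_, ?_⟩
        all_goals clear hF; grind
      · fin_cases z
        · right
          have hxv : x = v₁ := (l0 x).1 hz
          refine ⟨rfl, ?_, ?_⟩
          · rw [hxv]; exact ((hv2 v₁).2 (Or.inl rfl)).symm
          · rcases hF with ⟨rfl, hv⟩ | rfl
            · grind
            · rw [ml]; simp
        · exact absurd ((l1 x).1 hz) (by grind)
        · exact absurd hz (l2 x)
    obtain ⟨y, z, hy, hz, yS, zS, hyz⟩ := h (Sum.inl x) hxS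
    rcases key y hy yS with ⟨y', rfl, hy1, hy2, hy3⟩ | ⟨rfl, hy1, hy2⟩ <;>
    rcases key z hz zS with ⟨z', rfl, hz1, hz2, hz3⟩ | ⟨rfl, hz1, hz2⟩
    · exact ⟨y', z', hy2, hz2, hy3, hz3, fun e => hyz (by rw [e])⟩
    · exact ⟨y', v₂, hy2, hz1, hy3, hz2, hy1⟩
    · exact ⟨v₂, z', hy1, hz2, hy2, hz3, hz1.symm⟩
    · exact absurd rfl hyz

end

section
variable {V : Type*} [Finite V] {T' : SimpleGraph V} {T : SimpleGraph (V ⊕ Fin 3)}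
  {v₁ v₂ ℓ₂ a ℓ₁ b c d : V}

lemma Gad.ifacts (g : Gad T' v₁ v₂ ℓ₂ a ℓ₁ b c d) (P : Set V)
    (h : IsKIndOn T' 2 Set.univ P) :
    ¬ (v₂ ∈ P ∧ ℓ₂ ∈ P ∧ a ∈ P) ∧ ¬ (b ∈ P ∧ c ∈ P ∧ d ∈ P) := by
  rw [ind_iff] at h
  obtain ⟨hd, hv2, hl2, ha, hl1, hb, hc, hdd⟩ := g
  simp only [List.pairwise_cons, List.mem_cons] at hd
  constructor
  · rintro ⟨p1, p2, p3⟩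
    have := h v₂ p1 ℓ₂ a (by grind) (by grind) p2 p3
    grind
  · rintro ⟨p1, p2, p3⟩
    have := h c p2 b d (by grind) (by grind) p1 p3
    grind

lemma Gad.ifactsT (g : Gad T' v₁ v₂ ℓ₂ a ℓ₁ b c d) (gt : GadT T' T v₁ v₂) (S : Set (V ⊕ Fin 3))
    (h : IsKIndOn T 2 Set.univ S) :
    ¬ (Sum.inl v₂ ∈ S ∧ Sum.inl ℓ₂ ∈ S ∧ Sum.inl a ∈ S) ∧
      ¬ (Sum.inl b ∈ S ∧ Sum.inl c ∈ S ∧ Sum.inl d ∈ S) ∧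
      ¬ (Sum.inr 0 ∈ S ∧ Sum.inr 1 ∈ S ∧ Sum.inr 2 ∈ S) := by
  rw [ind_iff] at h
  obtain ⟨hd, hv2, hl2, ha, hl1, hb, hc, hdd⟩ := g
  obtain ⟨ll, l0, l1, l2, r01, r12, r02⟩ := gt
  simp only [List.pairwise_cons, List.mem_cons] at hd
  refine ⟨?_, ?_, ?_⟩
  · rintro ⟨p1, p2, p3⟩
    have := h _ p1 (Sum.inl ℓ₂) (Sum.inl a) (by grind) (by grind) p2 p3
    grind
  · rintro ⟨p1, p2, p3⟩
    have := h _ p2 (Sum.inl b) (Sum.inl d) (by grind) (by grind) p1 p3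
    grind
  · rintro ⟨p1, p2, p3⟩
    have := h _ p2 (Sum.inr 0) (Sum.inr 2) r01.symm r12 p1 p3
    simp at this

lemma indT_of_glue (g : Gad T' v₁ v₂ ℓ₂ a ℓ₁ b c d) (gt : GadT T' T v₁ v₂) (S' : Set V)
    (h : IsKIndOn T' 2 Set.univ S') :
    IsKIndOn T 2 Set.univ
      (glueT (glueV S' {v₂, ℓ₂, a, ℓ₁, b, c, d} {ℓ₁, ℓ₂, a, c, d}) {1, 2}) := by
  have out := g.out
  rw [ind_iff] at h ⊢
  obtain ⟨hd, hv2, hl2, ha, hl1, hb, hc, hdd⟩ := g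
  obtain ⟨ll, l0, l1, l2, r01, r12, r02⟩ := gt
  simp only [List.pairwise_cons, List.mem_cons] at hd
  have s0 : ∀ x, T.Adj (Sum.inr 0) (Sum.inl x) ↔ x = v₁ := fun x => by rw [T.adj_comm, l0]
  have s1 : ∀ x, T.Adj (Sum.inr 1) (Sum.inl x) ↔ x = v₂ := fun x => by rw [T.adj_comm, l1]
  have s2 : ∀ x, ¬ T.Adj (Sum.inr 2) (Sum.inl x) := fun x => by rw [T.adj_comm]; exact l2 x
  set H : Set V := {v₂, ℓ₂, a, ℓ₁, b, c, d} with hH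
  set S := glueT (glueV S' H {ℓ₁, ℓ₂, a, c, d}) {1, 2} with hS
  have mr : ∀ x, Sum.inr x ∈ S ↔ x = 1 ∨ x = 2 := fun x => Iff.rfl
  have ml : ∀ x, Sum.inl x ∈ S ↔ (x ∈ S' ∧ x ∉ H) ∨ x = ℓ₁ ∨ x = ℓ₂ ∨ x = a ∨ x = c ∨ x = d :=
    fun x => Iff.rfl
  have mH : ∀ x, x ∈ H ↔ x = v₂ ∨ x = ℓ₂ ∨ x = a ∨ x = ℓ₁ ∨ x = b ∨ x = c ∨ x = d :=
    fun x => by simp [hH]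
  clear_value S H
  rintro (x | x) hx
  · have key : ∀ z, T.Adj (Sum.inl x) z → z ∈ S → ∃ y, z = Sum.inl y ∧ T'.Adj x y ∧
        ((y ∈ S' ∧ y ∉ H) ∨ y = ℓ₁ ∨ y = ℓ₂ ∨ y = a ∨ y = c ∨ y = d) := by
      rintro (z | z) hz hzS
      · exact ⟨z, rfl, ((ll x z).1 hz).1, (ml z).1 hzS⟩
      · fin_cases z
        · have := (mr 0).1 hzS
          simp at this
        · have := (l1 x).1 hz
          grind
        · exact absurd hz (l2 x)
    intro y z hy hz yS zS
    obtain ⟨y, rfl, hy1, hy2⟩ := key y hy yS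
    obtain ⟨z, rfl, hz1, hz2⟩ := key z hz zS
    congr 1
    by_cases xH : x ∈ H
    · have hx' := (ml x).1 hx
      clear h ll l0 l1 l2 s0 s1 s2 mr ml key
      have o1 := out y x
      have o2 := out z x
      have o1' := hy1.symm
      have o2' := hz1.symm
      grind
    · have o1 := out x y xH hy1
      have o2 := out x z xH hz1
      have hyS : y ∈ S' := by clear h key; grind
      have hzS : z ∈ S' := by clear h key; grind
      have hxS : x ∈ S' := by clear h key; grind
      exact h x hxS y z hy1 hz1 hyS hzS
  · have key : ∀ z, T.Adj (Sum.inr x) z → z ∈ S → z = Sum.inr 1 ∨ z = Sum.inr 2 := by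
      rintro (z | z) hz hzS
      · fin_cases x
        · have := (mr 0).1 hx
          simp at this
        · have := (s1 z).1 hz
          grind
        · exact absurd hz (s2 z)
      · rcases (mr z).1 hzS with rfl | rfl <;> simp
    intro y z hy hz yS zS
    rcases (mr x).1 hx with rfl | rfl <;>
    rcases key y hy yS with rfl | rfl <;> rcases key z hz zS with rfl | rfl <;>
    first | rfl | exact absurd hy (T.irrefl) | exact absurd hz (T.irrefl)

lemma ind_of_glue (g : Gad T' v₁ v₂ ℓ₂ a ℓ₁ b c d) (gt : GadT T' T v₁ v₂) (S : Set (V ⊕ Fin 3))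
    (h : IsKIndOn T 2 Set.univ S) :
    IsKIndOn T' 2 Set.univ
      (glueV (Sum.inl ⁻¹' S) {v₂, ℓ₂, a, ℓ₁, b, c, d} {ℓ₁, ℓ₂, a, c, d}) := by
  have out := g.out
  rw [ind_iff] at h ⊢
  obtain ⟨hd, hv2, hl2, ha, hl1, hb, hc, hdd⟩ := g
  obtain ⟨ll, l0, l1, l2, r01, r12, r02⟩ := gt
  simp only [List.pairwise_cons, List.mem_cons] at hd
  set H : Set V := {v₂, ℓ₂, a, ℓ₁, b, c, d} with hH
  set P := glueV (Sum.inl ⁻¹' S) H {ℓ₁, ℓ₂, a, c, d} with hP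
  have ml : ∀ x, x ∈ P ↔ (Sum.inl x ∈ S ∧ x ∉ H) ∨ x = ℓ₁ ∨ x = ℓ₂ ∨ x = a ∨ x = c ∨ x = d :=
    fun x => Iff.rfl
  have mH : ∀ x, x ∈ H ↔ x = v₂ ∨ x = ℓ₂ ∨ x = a ∨ x = ℓ₁ ∨ x = b ∨ x = c ∨ x = d :=
    fun x => by simp [hH]
  clear_value P H
  intro x hx y z hy1 hz1 hy2 hz2
  by_cases xH : x ∈ H
  · rw [ml] at hx hy2 hz2
    clear h ll l0 l1 l2 ml
    have o1 := out y x
    have o2 := out z x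
    have o1' := hy1.symm
    have o2' := hz1.symm
    have hx2 : x = ℓ₁ ∨ x = ℓ₂ ∨ x = a ∨ x = c ∨ x = d := by
      rcases hx with hx | hx
      · exact absurd xH hx.2
      · exact hx
    clear hx hH hP
    rcases hx2 with rfl | rfl | rfl | rfl | rfl <;> grind
  · have o1 := out x y xH hy1
    have o2 := out x z xH hz1
    have hyS : Sum.inl y ∈ S ∧ y ∉ H := by clear h; grind
    have hzS : Sum.inl z ∈ S ∧ z ∉ H := by clear h; grind
    have hxS : Sum.inl x ∈ S := by clear h; grind
    have := h _ hxS (Sum.inl y) (Sum.inl z) (by clear h; grind) (by clear h; grind) hyS.1 hzS.1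
    exact Sum.inl_injective this

end

lemma memInd_le {W : Type*} (S : Set W) (x : W) : memInd S x ≤ 1 := by
  by_cases h : x ∈ S
  · rw [memInd_of_mem h]
  · rw [memInd_of_notMem h]; omega

lemma memInd_iff {W : Type*} (S : Set W) (x : W) : x ∈ S ↔ memInd S x = 1 := by
  by_cases h : x ∈ S
  · simp [memInd_of_mem h, h]
  · simp [memInd_of_notMem h, h]

lemma memInd_preimage {V : Type*} (S : Set (V ⊕ Fin 3)) (x : V) :
    memInd (Sum.inl ⁻¹' S : Set V) x = memInd S (Sum.inl x) := by
  by_cases h : Sum.inl x ∈ S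
  · rw [memInd_of_mem h, memInd_of_mem (show x ∈ Sum.inl ⁻¹' S from h)]
  · rw [memInd_of_notMem h, memInd_of_notMem (show x ∉ Sum.inl ⁻¹' S from h)]

section
variable {V : Type*} [Finite V] {v₁ v₂ ℓ₂ a ℓ₁ b c d : V}

lemma ncard_glueV (S F : Set V) (_hd : ([v₂, ℓ₂, a, ℓ₁, b, c, d] : List V).Pairwise (· ≠ ·))
    (hF : F ⊆ {v₂, ℓ₂, a, ℓ₁, b, c, d}) :
    (glueV S {v₂, ℓ₂, a, ℓ₁, b, c, d} F).ncard =
      (S \ {v₂, ℓ₂, a, ℓ₁, b, c, d}).ncard + F.ncard := by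
  have e : glueV S {v₂, ℓ₂, a, ℓ₁, b, c, d} F = (S \ {v₂, ℓ₂, a, ℓ₁, b, c, d}) ∪ F := rfl
  rw [e, Set.ncard_union_eq]
  rw [Set.disjoint_left]
  exact fun x hx hxF => hx.2 (hF hxF)

lemma ncard_glueT (P : Set V) (Q : Set (Fin 3)) : (glueT P Q).ncard = P.ncard + Q.ncard := by
  have e : glueT P Q = Sum.inl '' P ∪ Sum.inr '' Q := by
    ext (x | x) <;> simp [mem_glueT_l, mem_glueT_r]
  rw [e, Set.ncard_union_eq, Set.ncard_image_of_injective _ Sum.inl_injective,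
    Set.ncard_image_of_injective _ Sum.inr_injective]
  rw [Set.disjoint_left]
  rintro _ ⟨x, _, rfl⟩ ⟨y, _, h⟩
  simp at h

lemma ncard_F4 (s t u v : V) : ({s, t, u, v} : Set V).ncard ≤ 4 := by
  classical
  have := Finset.card_le_four (a := s) (b := t) (c := u) (d := v)
  rw [← Set.ncard_coe_finset] at this
  simpa using this

lemma ncard_F5 (s t u v w : V) : ({s, t, u, v, w} : Set V).ncard ≤ 5 := by
  classical
  have := Finset.card_le_five (a := s) (b := t) (c := u) (d := v) (e := w)
  rw [← Set.ncard_coe_finset] at this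
  simpa using this

lemma ncard_F5_eq (s t u v w : V) (h : ([s, t, u, v, w] : List V).Pairwise (· ≠ ·)) :
    ({s, t, u, v, w} : Set V).ncard = 5 := by
  classical
  have hn : ([s, t, u, v, w] : List V).Nodup := h
  have := List.toFinset_card_of_nodup hn
  rw [← Set.ncard_coe_finset] at this
  simpa using this

end

section
variable {V : Type*} [Finite V] {T' : SimpleGraph V} {T : SimpleGraph (V ⊕ Fin 3)}
  {v₁ v₂ ℓ₂ a ℓ₁ b c d : V}

lemma Gad.distH (g : Gad T' v₁ v₂ ℓ₂ a ℓ₁ b c d) :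
    ([v₂, ℓ₂, a, ℓ₁, b, c, d] : List V).Pairwise (· ≠ ·) := (List.pairwise_cons.1 g.dist).2

lemma dom_up (g : Gad T' v₁ v₂ ℓ₂ a ℓ₁ b c d) (gt : GadT T' T v₁ v₂) (S' : Set V)
    (h : IsKDomOn T' 2 Set.univ S') :
    ∃ S, IsKDomOn T 2 Set.univ S ∧ S.ncard ≤ S'.ncard + 2 := by
  have hs := ncard_split_H S' g.distH
  obtain ⟨f1, f2, f3, f4, f5, f6⟩ := g.facts S' h
  have i1 := memInd_of_mem f1
  have i2 := memInd_of_mem f2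
  have i3 := memInd_of_mem f3
  have hQ : ∀ i j : Fin 3, ({i, j} : Set (Fin 3)).ncard ≤ 2 := fun i j => by
    have := Set.ncard_insert_le i {j}
    rwa [Set.ncard_singleton] at this
  by_cases hc : memInd S' v₂ + memInd S' a + memInd S' b + memInd S' c ≤ 1
  · have hv : v₁ ∈ S' := by
      by_contra hv
      simp only [memInd_iff] at f4 f5 f6 hv
      omega
    have hb : 1 ≤ memInd S' b + memInd S' c := by
      simp only [memInd_iff] at f4
      omega
    refine ⟨_, domT_of_glue g gt S' h _ _ (Or.inl ⟨rfl, rfl, hv⟩), ?_⟩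
    rw [ncard_glueT, ncard_glueV _ _ g.distH (by
      rintro x (rfl | rfl | rfl | rfl) <;> simp)]
    have := ncard_F4 ℓ₁ ℓ₂ d b
    have := hQ 1 2
    omega
  · refine ⟨_, domT_of_glue g gt S' h _ _ (Or.inr ⟨rfl, rfl⟩), ?_⟩
    rw [ncard_glueT, ncard_glueV _ _ g.distH (by
      rintro x (rfl | rfl | rfl | rfl | rfl) <;> simp)]
    have := ncard_F5 ℓ₁ ℓ₂ d v₂ b
    have := hQ 0 2
    omega

lemma dom_down (g : Gad T' v₁ v₂ ℓ₂ a ℓ₁ b c d) (gt : GadT T' T v₁ v₂) (S : Set (V ⊕ Fin 3))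
    (h : IsKDomOn T 2 Set.univ S) :
    ∃ S', IsKDomOn T' 2 Set.univ S' ∧ S'.ncard + 2 ≤ S.ncard := by
  have hs0 := ncard_split_sum S
  have hs := ncard_split_H (Sum.inl ⁻¹' S : Set V) g.distH
  simp only [memInd_preimage] at hs
  obtain ⟨f1, f2, f3, f4, f5, f6, f7, f8⟩ := g.factsT gt S h
  have i1 := memInd_of_mem f1
  have i2 := memInd_of_mem f2
  have i3 := memInd_of_mem f3
  have i7 := memInd_of_mem f7
  simp only [memInd_iff] at f4 f5 f6 f8
  by_cases hv : Sum.inl v₁ ∈ S ∧ memInd S (Sum.inl v₂) + memInd S (Sum.inl a) +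
      memInd S (Sum.inl b) + memInd S (Sum.inl c) + memInd S (Sum.inr 0) +
      memInd S (Sum.inr 1) ≤ 2
  · refine ⟨_, dom_of_glue g gt S h _ (Or.inl ⟨rfl, hv.1⟩), ?_⟩
    rw [ncard_glueV _ _ g.distH (by
      rintro x (rfl | rfl | rfl | rfl) <;> simp)]
    have := ncard_F4 ℓ₁ ℓ₂ d b
    omega
  · rw [memInd_iff] at hv
    refine ⟨_, dom_of_glue g gt S h _ (Or.inr rfl), ?_⟩
    rw [ncard_glueV _ _ g.distH (by
      rintro x (rfl | rfl | rfl | rfl | rfl) <;> simp)]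
    have := ncard_F5 ℓ₁ ℓ₂ d v₂ b
    omega

lemma ind_up (g : Gad T' v₁ v₂ ℓ₂ a ℓ₁ b c d) (gt : GadT T' T v₁ v₂) (S' : Set V)
    (h : IsKIndOn T' 2 Set.univ S') :
    ∃ S, IsKIndOn T 2 Set.univ S ∧ S'.ncard + 2 ≤ S.ncard := by
  have hs := ncard_split_H S' g.distH
  obtain ⟨f1, f2⟩ := g.ifacts S' h
  have hd := g.distH
  refine ⟨_, indT_of_glue g gt S' h, ?_⟩
  rw [ncard_glueT, ncard_glueV _ _ g.distH (by
      rintro x (rfl | rfl | rfl | rfl | rfl) <;> simp),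
    ncard_F5_eq _ _ _ _ _ (by simp at hd ⊢; grind), Set.ncard_pair (by simp)]
  simp only [memInd_iff] at f1 f2
  have := memInd_le S' v₂
  have := memInd_le S' ℓ₂
  have := memInd_le S' a
  have := memInd_le S' ℓ₁
  have := memInd_le S' b
  have := memInd_le S' c
  have := memInd_le S' d
  omega

lemma ind_down (g : Gad T' v₁ v₂ ℓ₂ a ℓ₁ b c d) (gt : GadT T' T v₁ v₂) (S : Set (V ⊕ Fin 3))
    (h : IsKIndOn T 2 Set.univ S) :
    ∃ S', IsKIndOn T' 2 Set.univ S' ∧ S.ncard ≤ S'.ncard + 2 := by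
  have hs0 := ncard_split_sum S
  have hs := ncard_split_H (Sum.inl ⁻¹' S : Set V) g.distH
  simp only [memInd_preimage] at hs
  obtain ⟨f1, f2, f3⟩ := g.ifactsT gt S h
  have hd := g.distH
  refine ⟨_, ind_of_glue g gt S h, ?_⟩
  rw [ncard_glueV _ _ g.distH (by
      rintro x (rfl | rfl | rfl | rfl | rfl) <;> simp),
    ncard_F5_eq _ _ _ _ _ (by simp at hd ⊢; grind)]
  simp only [memInd_iff] at f1 f2 f3
  have := memInd_le S (Sum.inl v₂)
  have := memInd_le S (Sum.inl ℓ₂)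
  have := memInd_le S (Sum.inl a)
  have := memInd_le S (Sum.inl ℓ₁)
  have := memInd_le S (Sum.inl b)
  have := memInd_le S (Sum.inl c)
  have := memInd_le S (Sum.inl d)
  have := memInd_le S (Sum.inr 0)
  have := memInd_le S (Sum.inr 1)
  have := memInd_le S (Sum.inr 2)
  omega

end

lemma gamma_mem {W : Type*} [Finite W] (G : SimpleGraph W) :
    ∃ S, IsKDomOn G 2 Set.univ S ∧ S.ncard = gammaK G 2 Set.univ :=
  Nat.sInf_mem (s := {n | ∃ S, IsKDomOn G 2 Set.univ S ∧ S.ncard = n})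
    ⟨_, Set.univ, ⟨subset_rfl, fun v _ h => absurd (Set.mem_univ v) h⟩, rfl⟩

lemma gamma_le {W : Type*} (G : SimpleGraph W) (S : Set W)
    (h : IsKDomOn G 2 Set.univ S) : gammaK G 2 Set.univ ≤ S.ncard :=
  Nat.sInf_le ⟨S, h, rfl⟩

lemma alpha_bdd {W : Type*} [Finite W] (G : SimpleGraph W) :
    BddAbove {n | ∃ S, IsKIndOn G 2 Set.univ S ∧ S.ncard = n} := by
  refine ⟨Nat.card W, ?_⟩
  rintro _ ⟨S, _, rfl⟩
  rw [← Set.ncard_univ]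
  exact Set.ncard_le_ncard (Set.subset_univ S)

lemma alpha_mem {W : Type*} [Finite W] (G : SimpleGraph W) :
    ∃ S, IsKIndOn G 2 Set.univ S ∧ S.ncard = alphaK G 2 Set.univ :=
  Nat.sSup_mem (s := {n | ∃ S, IsKIndOn G 2 Set.univ S ∧ S.ncard = n})
    ⟨_, ∅, ⟨Set.empty_subset _, fun v h => absurd h (Set.notMem_empty v)⟩, rfl⟩ (alpha_bdd G)

lemma le_alpha {W : Type*} [Finite W] (G : SimpleGraph W) (S : Set W)
    (h : IsKIndOn G 2 Set.univ S) : S.ncard ≤ alphaK G 2 Set.univ :=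
  le_csSup (alpha_bdd G) ⟨S, h, rfl⟩

lemma nbr_eq {W : Type*} [Finite W] (G : SimpleGraph W) (v : W) (F : Set W)
    (hF : ∀ x ∈ F, G.Adj v x) (hc : (G.neighborSet v).ncard ≤ F.ncard) (x : W) :
    G.Adj v x ↔ x ∈ F := by
  have e := Set.eq_of_subset_of_ncard_le (s := F) (t := G.neighborSet v) hF hc
  rw [e]; rfl

theorem stmt18 {V : Type*} [Fintype V] (T' : SimpleGraph V) (hT' : T'.IsTree)
    (v₁ v₂ ℓ₂ a ℓ₁ b c d : V)
    (hdist : ([v₁, v₂, ℓ₂, a, ℓ₁, b, c, d] : List V).Pairwise (· ≠ ·))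
    (h1 : T'.Adj v₂ v₁) (h2 : T'.Adj v₂ ℓ₂) (h3 : T'.Adj v₂ a)
    (h4 : T'.Adj a ℓ₁) (h5 : T'.Adj a b) (h6 : T'.Adj b c) (h7 : T'.Adj c d)
    (hdl1 : (T'.neighborSet ℓ₁).ncard = 1) (hdl2 : (T'.neighborSet ℓ₂).ncard = 1)
    (hdd : (T'.neighborSet d).ncard = 1)
    (hdb : (T'.neighborSet b).ncard = 2) (hdc : (T'.neighborSet c).ncard = 2)
    (hdv2 : (T'.neighborSet v₂).ncard = 3) (hda : (T'.neighborSet a).ncard = 3)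
    (T : SimpleGraph (V ⊕ Fin 3))
    (hadj : ∀ a b, T.Adj a b ↔
      ((∃ x y, T'.Adj x y ∧ ¬(x = v₁ ∧ y = v₂) ∧ ¬(x = v₂ ∧ y = v₁) ∧ a = Sum.inl x ∧ b = Sum.inl y) ∨
       (a = (Sum.inr 0 : V ⊕ Fin 3) ∧ b = Sum.inr 1) ∨ (a = Sum.inr 1 ∧ b = (Sum.inr 0 : V ⊕ Fin 3)) ∨
       (a = (Sum.inr 1 : V ⊕ Fin 3) ∧ b = Sum.inr 2) ∨ (a = Sum.inr 2 ∧ b = (Sum.inr 1 : V ⊕ Fin 3)) ∨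
       (a = Sum.inl v₁ ∧ b = (Sum.inr 0 : V ⊕ Fin 3)) ∨ (a = (Sum.inr 0 : V ⊕ Fin 3) ∧ b = Sum.inl v₁) ∨
       (a = Sum.inl v₂ ∧ b = (Sum.inr 1 : V ⊕ Fin 3)) ∨ (a = (Sum.inr 1 : V ⊕ Fin 3) ∧ b = Sum.inl v₂))) :
    gammaK T 2 Set.univ = gammaK T' 2 Set.univ + 2 ∧
    alphaK T 2 Set.univ = alphaK T' 2 Set.univ + 2 ∧
    (alphaK T 2 Set.univ : ℤ) - (gammaK T 2 Set.univ : ℤ) =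
      (alphaK T' 2 Set.univ : ℤ) - (gammaK T' 2 Set.univ : ℤ) := by
  have hd := hdist
  simp only [List.pairwise_cons, List.mem_cons] at hd
  have c3 : ∀ x y z : V, x ≠ y → x ≠ z → y ≠ z → ({x, y, z} : Set V).ncard = 3 := by
    intro x y z h1 h2 h3
    rw [Set.ncard_eq_three]
    exact ⟨x, y, z, h1, h2, h3, rfl⟩
  have g : Gad T' v₁ v₂ ℓ₂ a ℓ₁ b c d := by
    refine ⟨hdist, nbr_eq T' v₂ {v₁, ℓ₂, a} ?_ ?_, nbr_eq T' ℓ₂ {v₂} ?_ ?_,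
      nbr_eq T' a {v₂, ℓ₁, b} ?_ ?_, nbr_eq T' ℓ₁ {a} ?_ ?_, nbr_eq T' b {a, c} ?_ ?_,
      nbr_eq T' c {b, d} ?_ ?_, nbr_eq T' d {c} ?_ ?_⟩
    · rintro x (rfl | rfl | rfl) <;> assumption
    · rw [hdv2, c3] <;> grind
    · rintro x rfl; exact h2.symm
    · rw [hdl2, Set.ncard_singleton]
    · rintro x (rfl | rfl | rfl)
      · exact h3.symm
      · exact h4
      · exact h5
    · rw [hda, c3] <;> grind
    · rintro x rfl; exact h4.symm
    · rw [hdl1, Set.ncard_singleton]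
    · rintro x (rfl | rfl)
      · exact h5.symm
      · exact h6
    · rw [hdb, Set.ncard_pair]; grind
    · rintro x (rfl | rfl)
      · exact h6.symm
      · exact h7
    · rw [hdc, Set.ncard_pair]; grind
    · rintro x rfl; exact h7.symm
    · rw [hdd, Set.ncard_singleton]
  have gt : GadT T' T v₁ v₂ := by
    refine ⟨?_, ?_, ?_, ?_, ?_, ?_, ?_⟩
    · intro x y
      rw [hadj]
      constructor
      · rintro (⟨x', y', h, p, q, e1, e2⟩ | h)
        · cases e1; cases e2; exact ⟨h, p, q⟩
        · simp at h
      · rintro ⟨h, p, q⟩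
        exact Or.inl ⟨x, y, h, p, q, rfl, rfl⟩
    all_goals simp [hadj]
  have hg : gammaK T 2 Set.univ = gammaK T' 2 Set.univ + 2 := by
    apply le_antisymm
    · obtain ⟨S', h, e⟩ := gamma_mem T'
      obtain ⟨S, h', e'⟩ := dom_up g gt S' h
      have := gamma_le T S h'
      omega
    · obtain ⟨S, h, e⟩ := gamma_mem T
      obtain ⟨S', h', e'⟩ := dom_down g gt S h
      have := gamma_le T' S' h'
      omega
  have ha : alphaK T 2 Set.univ = alphaK T' 2 Set.univ + 2 := by
    apply le_antisymm
    · obtain ⟨S, h, e⟩ := alpha_mem T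
      obtain ⟨S', h', e'⟩ := ind_down g gt S h
      have := le_alpha T' S' h'
      omega
    · obtain ⟨S', h, e⟩ := alpha_mem T'
      obtain ⟨S, h', e'⟩ := ind_up g gt S' h
      have := le_alpha T S h'
      omega
  refine ⟨hg, ha, ?_⟩
  rw [hg, ha]
  push_cast
  ring
end
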